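/- arXiv:1905.00712 — 6 statements merged into one kernel-verified Lean document; each statement's English description precedes it below -/
import Mathlib

section
/- For every natural number l ≥ 0 and all real numbers λ, μ, the determinant of M_l(λ,μ) vanishes if and only if λ(ξ_l − μ) = P_l − η_l·μ, and this in turn holds if and only if μ(η_l − λ) = P_l − ξ_l·λ. -/
/-- The matrix `M_l(λ,μ)` from Theorem `fundamental-2` of the paper, for the
multi-parameter biharmonic Steklov problems with `σ = 0` on the unit ball of `ℝ^N`. -/
noncomputable def steklovMatrix (N l : ℕ) (lam mu : ℝ) : Matrix (Fin 2) (Fin 2) ℝ :=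
  !![(l : ℝ) * ((l : ℝ) - 1 - lam), ((l : ℝ) + 2) * ((l : ℝ) + 1 - lam);
     (l : ℝ) * ((l : ℝ) + (N : ℝ) - 2) * ((l : ℝ) - 1) - mu,
     (l : ℝ) * ((l : ℝ) * ((l : ℝ) - 5) + (N : ℝ) * ((l : ℝ) - 1) - 2) - mu]

/-- `ξ_l`, the NBS eigenvalue on the unit ball associated with degree `l`. -/
noncomputable def xiBall (N l : ℕ) : ℝ :=
  (l : ℝ) * (2 * (l : ℝ) ^ 2 + ((N : ℝ) - 1) * (l : ℝ) - (N : ℝ) + 2)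

/-- `η_l`, the DBS eigenvalue on the unit ball associated with degree `l`. -/
noncomputable def etaBall (l : ℕ) : ℝ := 2 * (l : ℝ) + 1

/-- `P_l := 3l⁴ + 2(N−2)l³ − (N+1)l² − (N−2)l`. -/
noncomputable def PBall (N l : ℕ) : ℝ :=
  3 * (l : ℝ) ^ 4 + 2 * ((N : ℝ) - 2) * (l : ℝ) ^ 3 - ((N : ℝ) + 1) * (l : ℝ) ^ 2
    - ((N : ℝ) - 2) * (l : ℝ)

/-- The determinant of `M_l(λ,μ)` is twice the difference of the two sides of the relation
`λ(ξ_l − μ) = P_l − η_l μ`. -/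
theorem det_steklovMatrix (N l : ℕ) (lam mu : ℝ) :
    (steklovMatrix N l lam mu).det =
      2 * (lam * (xiBall N l - mu) - (PBall N l - etaBall l * mu)) := by
  rw [steklovMatrix, Matrix.det_fin_two_of, xiBall, PBall, etaBall]
  ring

/-- For every `l ≥ 0` and all real `λ, μ`, one has `det M_l(λ,μ) = 0` iff
`λ(ξ_l − μ) = P_l − η_l μ`, which in turn holds iff `μ(η_l − λ) = P_l − ξ_l λ`. -/
theorem det_steklovMatrix_eq_zero_iff (N : ℕ) (hN : 2 ≤ N) (l : ℕ) (lam mu : ℝ) :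
    ((steklovMatrix N l lam mu).det = 0 ↔
      lam * (xiBall N l - mu) = PBall N l - etaBall l * mu) ∧
    (lam * (xiBall N l - mu) = PBall N l - etaBall l * mu ↔
      mu * (etaBall l - lam) = PBall N l - xiBall N l * lam) := by
  refine ⟨?_, ?_⟩
  · rw [det_steklovMatrix, mul_eq_zero_iff_left two_ne_zero, sub_eq_zero]
  · constructor <;> intro h <;> linarith
end

section
/- For every natural number l ≥ 1 and all real numbers λ, μ with μ ≠ ξ_l, the determinant of M_l(λ,μ) vanishes if and only if λ = (P_l − η_l·μ)/(ξ_l − μ). -/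
/-- For `l ≥ 1` and `μ ≠ ξ_l`, the determinant of `M_l(λ,μ)` vanishes iff
`λ = (P_l − η_l μ)/(ξ_l − μ)`. -/
theorem det_steklovMatrix_eq_zero_iff_lam_eq (N : ℕ) (hN : 2 ≤ N) (l : ℕ) (hl : 1 ≤ l)
    (lam mu : ℝ) (hmu : mu ≠ xiBall N l) :
    (steklovMatrix N l lam mu).det = 0 ↔
      lam = (PBall N l - etaBall l * mu) / (xiBall N l - mu) := by
  rw [det_steklovMatrix, eq_div_iff (sub_ne_zero.mpr hmu.symm), mul_eq_zero, sub_eq_zero]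
  exact or_iff_right two_ne_zero
end

section
/- For every natural number l ≥ 0 and every real μ < 0, there exists exactly one real number λ such that det M_l(λ,μ) = 0; moreover this λ satisfies 0 < λ ≤ 2l+1 = η_l, with equality λ = η_l if and only if l = 0. (This is the ball analogue of the positivity of the eigenvalues of problem (BS_μ) for μ < 0 and of the bound λ_j(μ) ≤ η_j.) -/
/-- Up to the factor `2`, the determinant is affine in `lam`, written in terms of
`A - mu` with `A = l (l + N - 2) (l - 1)`. -/
theorem steklovMatrix_det (N l : ℕ) (lam mu : ℝ) :
    (steklovMatrix N l lam mu).det =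
      2 * (lam * ((l : ℝ) * (l + N - 2) * (l - 1) - mu + (l : ℝ) ^ 2 * (l + 2)) -
        ((2 * l + 1) * ((l : ℝ) * (l + N - 2) * (l - 1) - mu) +
          (l : ℝ) ^ 2 * (l - 1) * (l + 2))) := by
  rw [steklovMatrix, Matrix.det_fin_two_of]
  ring

theorem steklovMatrix_coeff_nonneg (N : ℕ) (hN : 2 ≤ N) (l : ℕ) :
    0 ≤ (l : ℝ) * (l + N - 2) * (l - 1) ∧ 0 ≤ (l : ℝ) ^ 2 * (l - 1) * (l + 2) := by
  rcases Nat.eq_zero_or_pos l with rfl | hl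
  · simp
  · have hl' : (0 : ℝ) ≤ l - 1 := sub_nonneg.2 (by exact_mod_cast hl)
    have hN' : (0 : ℝ) ≤ N - 2 := sub_nonneg.2 (by exact_mod_cast hN)
    have h : (0 : ℝ) ≤ l + N - 2 := by linarith
    constructor <;> positivity

/-- For every `l ≥ 0` and every real `μ < 0` there is exactly one real `λ` with
`det M_l(λ,μ) = 0`; moreover this `λ` satisfies `0 < λ ≤ 2l+1 = η_l`, with equality
`λ = η_l` iff `l = 0`. -/
theorem steklovMatrix_unique_root_of_mu_neg (N : ℕ) (hN : 2 ≤ N) (l : ℕ)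
    (mu : ℝ) (hmu : mu < 0) :
    (∃! lam : ℝ, (steklovMatrix N l lam mu).det = 0) ∧
    (∀ lam : ℝ, (steklovMatrix N l lam mu).det = 0 →
      0 < lam ∧ lam ≤ 2 * (l : ℝ) + 1 ∧ 2 * (l : ℝ) + 1 = etaBall l ∧
        (lam = etaBall l ↔ l = 0)) := by
  obtain ⟨hA, hB⟩ := steklovMatrix_coeff_nonneg N hN l
  simp only [steklovMatrix_det]
  have hX : 0 < (l : ℝ) * (l + N - 2) * (l - 1) - mu := by linarith
  generalize (l : ℝ) * (l + N - 2) * (l - 1) - mu = X at hX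
  have hS : 0 < X + (l : ℝ) ^ 2 * (l + 2) := by positivity
  have hT : 0 < (2 * l + 1) * X + (l : ℝ) ^ 2 * (l - 1) * (l + 2) := by positivity
  have root_iff (lam : ℝ) : 2 * (lam * (X + (l : ℝ) ^ 2 * (l + 2)) -
      ((2 * l + 1) * X + (l : ℝ) ^ 2 * (l - 1) * (l + 2))) = 0 ↔
      lam = ((2 * l + 1) * X + (l : ℝ) ^ 2 * (l - 1) * (l + 2)) /
        (X + (l : ℝ) ^ 2 * (l + 2)) := by
    rw [eq_div_iff hS.ne', mul_eq_zero, sub_eq_zero]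
    simp
  simp only [root_iff]
  refine ⟨⟨_, rfl, fun _ h => h⟩, ?_⟩
  rintro _ rfl
  have gap : (2 * (l : ℝ) + 1) * (X + (l : ℝ) ^ 2 * (l + 2)) -
      ((2 * l + 1) * X + (l : ℝ) ^ 2 * (l - 1) * (l + 2)) = (l : ℝ) ^ 2 * (l + 2) ^ 2 := by
    ring
  refine ⟨div_pos hT hS, ?_, rfl, ?_⟩
  · rw [div_le_iff₀ hS, ← sub_nonneg, gap]
    positivity
  · have hl : (l : ℝ) + 2 ≠ 0 := by positivity
    rw [etaBall, div_eq_iff hS.ne', eq_comm, ← sub_eq_zero, gap]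
    simp [hl]
end

section
/- The sequence of NBS eigenvalues on the unit ball, ξ_j := ξ_{ℓ(j)} = ℓ(j)(2ℓ(j)²+(N−1)ℓ(j)−N+2), satisfies the Weyl-type asymptotic law lim_{j→∞} ξ_j / j^{3/(N−1)} = 2^{(N−4)/(N−1)} ((N−1)!)^{3/(N−1)}. -/
/-- `D_N(ℓ) = (2ℓ+N−1)(N+ℓ−2)!/(ℓ!(N−1)!)`, the dimension of the space of spherical
harmonics of degree at most `ℓ` in `ℝ^N` (as a real number). -/
noncomputable def harmDim (N l : ℕ) : ℝ :=
  (2 * (l : ℝ) + (N : ℝ) - 1) * (Nat.factorial (N + l - 2) : ℝ) /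
    ((Nat.factorial l : ℝ) * (Nat.factorial (N - 1) : ℝ))

/-- `L : ℕ → ℕ` assigns to each index `j ≥ 1` the unique degree `ℓ(j)` with
`D_N(ℓ(j)−1) < j ≤ D_N(ℓ(j))` (with the convention `D_N(−1) = 0`, i.e. all lower
degrees `m < ℓ(j)` satisfy `D_N(m) < j`). -/
def IsDegreeCount (N : ℕ) (L : ℕ → ℕ) : Prop :=
  ∀ j : ℕ, 1 ≤ j → (j : ℝ) ≤ harmDim N (L j) ∧ ∀ m : ℕ, m < L j → harmDim N m < (j : ℝ)

open Filter Topology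

theorem harmDim_le (n l : ℕ) :
    harmDim (n + 2) l ≤ ((l : ℝ) + (n + 1)) ^ (n + 1) / (((n + 1).factorial : ℝ) / 2) := by
  have hfac : ((n + l).factorial : ℝ) ≤ l.factorial * ((l : ℝ) + (n + 1)) ^ n := by
    have h : ((l + n).factorial : ℝ) ≤ l.factorial * ((l : ℝ) + n) ^ n := by
      rw [← Nat.factorial_mul_ascFactorial]
      exact_mod_cast Nat.mul_le_mul_left _ (Nat.ascFactorial_le_pow_add l n)
    rw [add_comm n l]
    refine h.trans ?_
    gcongr
    linarith
  have hl : (0 : ℝ) < l.factorial := by positivity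
  have hn : (0 : ℝ) < (n + 1).factorial := by positivity
  rw [harmDim, show n + 2 + l - 2 = n + l by omega, show n + 2 - 1 = n + 1 by omega,
    div_le_div_iff₀ (by positivity) (by positivity)]
  push_cast
  calc _ ≤ (2 * ((l : ℝ) + (n + 1))) * (l.factorial * ((l : ℝ) + (n + 1)) ^ n)
        * ((n + 1).factorial / 2) := by
        gcongr
        linarith [(n.cast_nonneg : (0 : ℝ) ≤ n)]
    _ = _ := by ring

theorem pow_div_le_harmDim (n l : ℕ) :
    (l : ℝ) ^ (n + 1) / (((n + 1).factorial : ℝ) / 2) ≤ harmDim (n + 2) l := by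
  have hfac : (l.factorial : ℝ) * (l : ℝ) ^ n ≤ (n + l).factorial := by
    have h : (l.factorial : ℝ) * ((l : ℝ) + 1) ^ n ≤ (l + n).factorial := by
      exact_mod_cast Nat.factorial_mul_pow_le_factorial
    rw [add_comm n l]
    refine le_trans ?_ h
    gcongr
    linarith
  have hl : (0 : ℝ) < l.factorial := by positivity
  have hn : (0 : ℝ) < (n + 1).factorial := by positivity
  rw [harmDim, show n + 2 + l - 2 = n + l by omega, show n + 2 - 1 = n + 1 by omega,
    div_le_div_iff₀ (by positivity) (by positivity)]
  push_cast
  calc _ = (2 * (l : ℝ)) * (l.factorial * (l : ℝ) ^ n) * ((n + 1).factorial / 2) := by ring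
    _ ≤ _ := by
        gcongr <;> linarith [(n.cast_nonneg : (0 : ℝ) ≤ n), (l.cast_nonneg : (0 : ℝ) ≤ l)]

/-- The degree `ℓ(j)` stays within bounded distance of `((N-1)! j / 2)^{1/(N-1)}`. -/
theorem IsDegreeCount.bounds {n : ℕ} {L : ℕ → ℕ} (hL : IsDegreeCount (n + 2) L) {j : ℕ}
    (hj : 1 ≤ j) {x : ℝ} (hx : 0 ≤ x)
    (hxj : x ^ (n + 1) = ((n + 1).factorial : ℝ) / 2 * j) :
    x - (n + 1) ≤ L j ∧ (L j : ℝ) ≤ x + 1 := by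
  obtain ⟨hup, hlow⟩ := hL j hj
  have hc : (0 : ℝ) < ((n + 1).factorial : ℝ) / 2 := by positivity
  constructor
  · have h := hup.trans (harmDim_le n (L j))
    rw [le_div_iff₀ hc, mul_comm, ← hxj] at h
    linarith [le_of_pow_le_pow_left₀ n.succ_ne_zero (by positivity) h]
  · rcases Nat.eq_zero_or_pos (L j) with h0 | hpos
    · rw [h0, Nat.cast_zero]
      linarith
    · have h := (pow_div_le_harmDim n (L j - 1)).trans (hlow (L j - 1) (by omega)).le
      rw [div_le_iff₀ hc, mul_comm, ← hxj, Nat.cast_sub hpos, Nat.cast_one] at h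
      linarith [le_of_pow_le_pow_left₀ n.succ_ne_zero hx h]

theorem tendsto_div_of_sub_bounded {u x : ℕ → ℝ} {a b : ℝ} (hx : Tendsto x atTop atTop)
    (hu : ∀ᶠ j in atTop, x j - a ≤ u j ∧ u j ≤ x j + b) :
    Tendsto (fun j => u j / x j) atTop (𝓝 1) := by
  have hlow : Tendsto (fun j => 1 - a / x j) atTop (𝓝 1) := by
    simpa using tendsto_const_nhds.sub (hx.const_div_atTop a)
  have hup : Tendsto (fun j => 1 + b / x j) atTop (𝓝 1) := by
    simpa using tendsto_const_nhds.add (hx.const_div_atTop b)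
  refine tendsto_of_tendsto_of_tendsto_of_le_of_le' hlow hup ?_ ?_ <;>
    filter_upwards [hu, hx.eventually_gt_atTop 0] with j hj hpos
  · rw [le_div_iff₀ hpos, sub_mul, div_mul_cancel₀ _ hpos.ne']
    linarith [hj.1]
  · rw [div_le_iff₀ hpos, add_mul, div_mul_cancel₀ _ hpos.ne']
    linarith [hj.2]

theorem tendsto_xiBall_div_pow (N : ℕ) {L : ℕ → ℕ} {x : ℕ → ℝ} (hx : Tendsto x atTop atTop)
    (hLx : Tendsto (fun j => (L j : ℝ) / x j) atTop (𝓝 1)) :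
    Tendsto (fun j => xiBall N (L j) / x j ^ 3) atTop (𝓝 2) := by
  have hinv : Tendsto (fun j => (x j)⁻¹) atTop (𝓝 0) := tendsto_inv_atTop_zero.comp hx
  have h := hLx.mul ((((hLx.pow 2).const_mul 2).add ((hLx.mul hinv).const_mul ((N : ℝ) - 1))).add
    ((hinv.pow 2).const_mul (2 - (N : ℝ))))
  norm_num at h
  refine h.congr' ?_
  filter_upwards [hx.eventually_gt_atTop 0] with j hpos
  rw [xiBall]
  field_simp
  ring

/-- Weyl-type law for the NBS eigenvalues `ξ_j = ξ_{ℓ(j)}` on the unit ball: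
`ξ_j / j^{3/(N−1)} → 2^{(N−4)/(N−1)} ((N−1)!)^{3/(N−1)}` as `j → ∞`. -/
theorem xiBall_weyl_asymptotics (N : ℕ) (hN : 2 ≤ N) (L : ℕ → ℕ)
    (hL : IsDegreeCount N L) :
    Tendsto (fun j : ℕ => xiBall N (L j) / (j : ℝ) ^ ((3 : ℝ) / ((N : ℝ) - 1)))
      atTop
      (𝓝 ((2 : ℝ) ^ (((N : ℝ) - 4) / ((N : ℝ) - 1)) *
        (Nat.factorial (N - 1) : ℝ) ^ ((3 : ℝ) / ((N : ℝ) - 1)))) := by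
  obtain ⟨n, rfl⟩ := Nat.exists_eq_add_of_le' hN
  have hp : (0 : ℝ) < (n : ℝ) + 1 := by positivity
  rw [show ((n + 2 : ℕ) : ℝ) - 1 = n + 1 by push_cast; ring,
    show ((n + 2 : ℕ) : ℝ) - 4 = (n + 1) - 3 by push_cast; ring,
    show n + 2 - 1 = n + 1 by omega]
  set c : ℝ := ((n + 1).factorial : ℝ) / 2 with hcdef
  have hc : 0 < c := by positivity
  set x : ℕ → ℝ := fun j => (c * j) ^ (1 / ((n : ℝ) + 1)) with hxdef
  have hx : Tendsto x atTop atTop :=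
    (tendsto_rpow_atTop (by positivity)).comp
      (tendsto_natCast_atTop_atTop.const_mul_atTop hc)
  have hxpow (j : ℕ) : x j ^ (n + 1) = c * j := by
    have := Real.rpow_inv_natCast_pow (x := c * j) (by positivity) n.succ_ne_zero
    simpa [hxdef] using this
  have hratio : Tendsto (fun j => (L j : ℝ) / x j) atTop (𝓝 1) := by
    refine tendsto_div_of_sub_bounded (a := n + 1) (b := 1) hx ?_
    filter_upwards [eventually_ge_atTop 1] with j hj
    exact hL.bounds hj (by positivity) (hxpow j)
  have hcube (j : ℕ) : x j ^ 3 = c ^ (3 / ((n : ℝ) + 1)) * (j : ℝ) ^ (3 / ((n : ℝ) + 1)) := by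
    rw [← Real.mul_rpow hc.le j.cast_nonneg, ← Real.rpow_natCast, ← Real.rpow_mul (by positivity)]
    congr 1
    push_cast
    ring
  have hconst : (2 : ℝ) ^ (((n : ℝ) + 1 - 3) / (n + 1)) *
      ((n + 1).factorial : ℝ) ^ (3 / ((n : ℝ) + 1)) = c ^ (3 / ((n : ℝ) + 1)) * 2 := by
    rw [hcdef, Real.div_rpow (by positivity) (by positivity), sub_div, div_self hp.ne',
      Real.rpow_sub two_pos, Real.rpow_one]
    ring
  rw [hconst]
  refine ((tendsto_xiBall_div_pow (n + 2) hx hratio).const_mul _).congr fun j => ?_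
  have hcr : c ^ (3 / ((n : ℝ) + 1)) ≠ 0 := (Real.rpow_pos_of_pos hc _).ne'
  rw [hcube, ← mul_div_assoc, mul_div_mul_left _ _ hcr]
end

section
/- The sequence of DBS eigenvalues on the unit ball, η_j := η_{ℓ(j)} = 2ℓ(j)+1, satisfies the Weyl-type asymptotic law lim_{j→∞} η_j / j^{1/(N−1)} = 2^{(N−2)/(N−1)} ((N−1)!)^{1/(N−1)}. -/
open Filter Topology

theorem tendsto_affine_div_affine (a b c d : ℝ) (hc : c ≠ 0) :
    Tendsto (fun l : ℕ => (a * (l : ℝ) + b) / (c * (l : ℝ) + d)) atTop (𝓝 (a / c)) := by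
  have hinv : Tendsto (fun l : ℕ => ((l : ℝ))⁻¹) atTop (𝓝 0) :=
    tendsto_inv_atTop_zero.comp tendsto_natCast_atTop_atTop
  have hlim : Tendsto (fun l : ℕ => (a + b * (l : ℝ)⁻¹) / (c + d * (l : ℝ)⁻¹)) atTop
      (𝓝 ((a + b * 0) / (c + d * 0))) :=
    ((hinv.const_mul b).const_add a).div ((hinv.const_mul d).const_add c) (by simpa using hc)
  simp only [mul_zero, add_zero] at hlim
  refine hlim.congr' ?_
  filter_upwards [eventually_ne_atTop 0] with l hl
  have hl' : (l : ℝ) ≠ 0 := by exact_mod_cast hl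
  rw [← mul_div_mul_right _ _ hl']
  congr 1 <;> field_simp

/-- `(l + k)! / l!` grows like `l ^ k`. -/
theorem tendsto_factorial_add_div_pow (d : ℝ) (k : ℕ) :
    Tendsto (fun l : ℕ => (Nat.factorial (l + k) : ℝ) /
      ((Nat.factorial l : ℝ) * (2 * (l : ℝ) + d) ^ k)) atTop (𝓝 ((1 / 2) ^ k)) := by
  induction k with
  | zero =>
    simp [Nat.factorial_ne_zero]
  | succ k ih =>
    have h := ih.mul (tendsto_affine_div_affine 1 (k + 1) 2 d two_ne_zero)
    rw [pow_succ]
    refine h.congr fun l => ?_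
    rw [div_mul_div_comm, ← add_assoc l k 1, Nat.factorial_succ, pow_succ]
    push_cast
    congr 1 <;> ring

theorem tendsto_harmDim_div_pow (n : ℕ) (d : ℝ) :
    Tendsto (fun l : ℕ => harmDim (n + 2) l / (2 * (l : ℝ) + d) ^ (n + 1)) atTop
      (𝓝 ((1 / 2) ^ n / (Nat.factorial (n + 1) : ℝ))) := by
  have h := ((tendsto_affine_div_affine 2 (n + 1) 2 d two_ne_zero).mul
    (tendsto_factorial_add_div_pow d n)).div_const (Nat.factorial (n + 1) : ℝ)
  rw [div_self two_ne_zero, one_mul] at h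
  refine h.congr fun l => ?_
  have hsub : n + 2 + l - 2 = l + n := by omega
  rw [harmDim, hsub, div_mul_div_comm, div_div, div_div, pow_succ]
  push_cast
  congr 1
  · ring
  · ring

theorem IsDegreeCount.tendsto_atTop {N : ℕ} {L : ℕ → ℕ} (hL : IsDegreeCount N L) :
    Tendsto L atTop atTop := by
  rw [Filter.tendsto_atTop]
  intro m
  have h : ∀ᶠ j : ℕ in atTop, ∀ i ∈ Finset.range m, harmDim N i < (j : ℝ) :=
    (Filter.eventually_all_finset _).2 fun i _ =>
      tendsto_natCast_atTop_atTop.eventually_gt_atTop (harmDim N i)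
  filter_upwards [h, eventually_ge_atTop 1] with j hj hj1
  by_contra! hlt
  exact (hj (L j) (Finset.mem_range.2 hlt)).not_ge (hL j hj1).1

theorem IsDegreeCount.tendsto_div_etaBall_pow {n : ℕ} {L : ℕ → ℕ}
    (hL : IsDegreeCount (n + 2) L) :
    Tendsto (fun j : ℕ => (j : ℝ) / etaBall (L j) ^ (n + 1)) atTop
      (𝓝 ((1 / 2) ^ n / (Nat.factorial (n + 1) : ℝ))) := by
  have hupper := (tendsto_harmDim_div_pow n 1).comp hL.tendsto_atTop
  have hlower := (tendsto_harmDim_div_pow n 3).comp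
    ((tendsto_sub_atTop_nat 1).comp hL.tendsto_atTop)
  refine tendsto_of_tendsto_of_tendsto_of_le_of_le' hlower hupper ?_ ?_
  · filter_upwards [eventually_ge_atTop 1, hL.tendsto_atTop.eventually_ge_atTop 1] with j hj hLj
    have heq : 2 * ((L j - 1 : ℕ) : ℝ) + 3 = etaBall (L j) := by
      rw [etaBall, Nat.cast_sub hLj]
      push_cast
      ring
    simp only [Function.comp_apply, heq]
    have hpos : 0 < etaBall (L j) := by unfold etaBall; positivity
    gcongr
    exact ((hL j hj).2 (L j - 1) (by omega)).le
  · filter_upwards [eventually_ge_atTop 1] with j hj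
    have hpos : 0 < etaBall (L j) := by unfold etaBall; positivity
    change (j : ℝ) / etaBall (L j) ^ (n + 1) ≤ harmDim (n + 2) (L j) / etaBall (L j) ^ (n + 1)
    gcongr
    exact (hL j hj).1

/-- Weyl-type law for the DBS eigenvalues `η_j = η_{ℓ(j)} = 2ℓ(j)+1` on the unit ball:
`η_j / j^{1/(N−1)} → 2^{(N−2)/(N−1)} ((N−1)!)^{1/(N−1)}` as `j → ∞`. -/
theorem etaBall_weyl_asymptotics (N : ℕ) (hN : 2 ≤ N) (L : ℕ → ℕ)
    (hL : IsDegreeCount N L) :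
    Tendsto (fun j : ℕ => etaBall (L j) / (j : ℝ) ^ ((1 : ℝ) / ((N : ℝ) - 1)))
      atTop
      (𝓝 ((2 : ℝ) ^ (((N : ℝ) - 2) / ((N : ℝ) - 1)) *
        (Nat.factorial (N - 1) : ℝ) ^ ((1 : ℝ) / ((N : ℝ) - 1)))) := by
  obtain ⟨n, rfl⟩ := Nat.exists_eq_add_of_le' hN
  have hcast : ((n + 2 : ℕ) : ℝ) - 1 = ((n + 1 : ℕ) : ℝ) := by push_cast; ring
  have hcast' : ((n + 2 : ℕ) : ℝ) - 2 = (n : ℝ) := by push_cast; ring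
  rw [hcast, hcast', show n + 2 - 1 = n + 1 from rfl]
  have hfac : (0 : ℝ) < (Nat.factorial (n + 1) : ℝ) := by positivity
  have hratio := hL.tendsto_div_etaBall_pow.inv₀ (by positivity)
  have hroot := hratio.rpow_const (p := 1 / ((n + 1 : ℕ) : ℝ)) (Or.inr (by positivity))
  have hlim : (((1 / 2 : ℝ) ^ n / (Nat.factorial (n + 1) : ℝ))⁻¹) ^ (1 / ((n + 1 : ℕ) : ℝ)) =
      (2 : ℝ) ^ ((n : ℝ) / ((n + 1 : ℕ) : ℝ)) *
        (Nat.factorial (n + 1) : ℝ) ^ ((1 : ℝ) / ((n + 1 : ℕ) : ℝ)) := by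
    have hinv : ((1 / 2 : ℝ) ^ n / (Nat.factorial (n + 1) : ℝ))⁻¹ =
        2 ^ n * (Nat.factorial (n + 1) : ℝ) := by
      rw [inv_div, one_div, inv_pow, div_inv_eq_mul, mul_comm]
    rw [hinv, Real.mul_rpow (by positivity) hfac.le, ← Real.rpow_natCast 2 n,
      ← Real.rpow_mul zero_le_two, mul_one_div]
  rw [hlim] at hroot
  refine hroot.congr fun j => ?_
  have hpos : 0 ≤ etaBall (L j) := by unfold etaBall; positivity
  rw [inv_div, Real.div_rpow (by positivity) (by positivity), one_div,
    Real.pow_rpow_inv_natCast hpos n.succ_ne_zero]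
end

section
/- For each real μ < 0 and each integer j ≥ 1 define λ_j(μ) := the infimum, over all j-dimensional subspaces V of H, of sup { (‖v‖_H² − μ ‖γ₀ v‖²) / ‖γ₁ v‖² : v ∈ V, γ₁ v ≠ 0 } (a value in [0, +∞]). Then for all μ₁ < μ₂ < 0: λ_j(μ₂) ≤ λ_j(μ₁), and if λ_j(μ₁) < ∞ then λ_j(μ₁) − λ_j(μ₂) ≤ λ_j(μ₁) · (μ₂ − μ₁)/(−μ₁); consequently |λ_j(μ₁) − λ_j(μ₂)| ≤ λ_j(μ₁) |μ₂ − μ₁| / |μ₁|, so on every half-line (−∞, −δ] with δ > 0 the function μ ↦ λ_j(μ) is Lipschitz continuous wherever it is finite. -/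
open scoped ENNReal

/-- The min-max value `λ_j(μ)` (with values in `[0,+∞]`): the infimum over all
`j`-dimensional subspaces `V` of `H` of
`sup { (‖v‖² − μ‖γ₀v‖²)/‖γ₁v‖² : v ∈ V, γ₁v ≠ 0 }`. -/
noncomputable def steklovMuEig {H K₀ K₁ : Type*} [NormedAddCommGroup H]
    [InnerProductSpace ℝ H] [NormedAddCommGroup K₀] [InnerProductSpace ℝ K₀]
    [NormedAddCommGroup K₁] [InnerProductSpace ℝ K₁]
    (γ₀ : H →L[ℝ] K₀) (γ₁ : H →L[ℝ] K₁) (j : ℕ) (mu : ℝ) : ℝ≥0∞ :=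
  ⨅ (V : Submodule ℝ H) (_ : Module.finrank ℝ V = j),
    ⨆ (v : V) (_ : γ₁ (v : H) ≠ 0),
      ENNReal.ofReal ((‖(v : H)‖ ^ 2 - mu * ‖γ₀ (v : H)‖ ^ 2) / ‖γ₁ (v : H)‖ ^ 2)

section

variable {H K₀ K₁ : Type*} [NormedAddCommGroup H]
    [InnerProductSpace ℝ H] [NormedAddCommGroup K₀] [InnerProductSpace ℝ K₀]
    [NormedAddCommGroup K₁] [InnerProductSpace ℝ K₁]

/-- The min-max value `λ_j(μ)` is nonincreasing in `μ`. -/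
theorem steklovMuEig_antitone (γ₀ : H →L[ℝ] K₀) (γ₁ : H →L[ℝ] K₁) (j : ℕ) :
    Antitone (steklovMuEig γ₀ γ₁ j) := by
  intro a b hab
  unfold steklovMuEig
  gcongr

/-- For `μ₁ ≤ μ₂ < 0`, the min-max values satisfy `(μ₂/μ₁) λ_j(μ₁) ≤ λ_j(μ₂)`. -/
theorem ofReal_div_mul_steklovMuEig_le (γ₀ : H →L[ℝ] K₀) (γ₁ : H →L[ℝ] K₁) (j : ℕ)
    {mu₁ mu₂ : ℝ} (h12 : mu₁ ≤ mu₂) (h2 : mu₂ < 0) :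
    ENNReal.ofReal (mu₂ / mu₁) * steklovMuEig γ₀ γ₁ j mu₁ ≤ steklovMuEig γ₀ γ₁ j mu₂ := by
  have h1 : mu₁ < 0 := h12.trans_lt h2
  have hc : 0 ≤ mu₂ / mu₁ := div_nonneg_of_nonpos h2.le h1.le
  have hc1 : mu₂ / mu₁ ≤ 1 := (div_le_one_of_neg h1).2 h12
  refine le_iInf₂ fun V hV => (mul_le_mul_right (iInf₂_le V hV) _).trans ?_
  simp only [ENNReal.mul_iSup]
  gcongr with v hv
  rw [← ENNReal.ofReal_mul hc, ← mul_div_assoc]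
  gcongr
  rw [mul_sub, ← mul_assoc, div_mul_cancel₀ _ h1.ne]
  gcongr
  exact mul_le_of_le_one_left (sq_nonneg _) hc1

end

/-- Let `H` be a real Hilbert space and `γ₀ : H → K₀`, `γ₁ : H → K₁` bounded linear
operators into Hilbert spaces, and for `μ < 0`, `j ≥ 1` let `λ_j(μ)` be the min-max value
above. Then for all `μ₁ < μ₂ < 0`: `λ_j(μ₂) ≤ λ_j(μ₁)`; if `λ_j(μ₁) < ∞` then
`λ_j(μ₁) − λ_j(μ₂) ≤ λ_j(μ₁)(μ₂ − μ₁)/(−μ₁)`, and consequently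
`|λ_j(μ₁) − λ_j(μ₂)| ≤ λ_j(μ₁)|μ₂ − μ₁|/|μ₁|`; hence on every half-line `(−∞,−δ]` the
function `μ ↦ λ_j(μ)` is Lipschitz continuous wherever it is finite. -/
theorem steklovMuEig_lipschitz {H K₀ K₁ : Type*} [NormedAddCommGroup H]
    [InnerProductSpace ℝ H] [NormedAddCommGroup K₀] [InnerProductSpace ℝ K₀]
    [NormedAddCommGroup K₁] [InnerProductSpace ℝ K₁]
    (γ₀ : H →L[ℝ] K₀) (γ₁ : H →L[ℝ] K₁) (j : ℕ) (hj : 1 ≤ j)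
    (mu₁ mu₂ : ℝ) (h12 : mu₁ < mu₂) (h2 : mu₂ < 0) :
    steklovMuEig γ₀ γ₁ j mu₂ ≤ steklovMuEig γ₀ γ₁ j mu₁ ∧
    (steklovMuEig γ₀ γ₁ j mu₁ ≠ ⊤ →
      (steklovMuEig γ₀ γ₁ j mu₁).toReal - (steklovMuEig γ₀ γ₁ j mu₂).toReal ≤
        (steklovMuEig γ₀ γ₁ j mu₁).toReal * (mu₂ - mu₁) / (-mu₁)) ∧
    (steklovMuEig γ₀ γ₁ j mu₁ ≠ ⊤ →
      |(steklovMuEig γ₀ γ₁ j mu₁).toReal - (steklovMuEig γ₀ γ₁ j mu₂).toReal| ≤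
        (steklovMuEig γ₀ γ₁ j mu₁).toReal * |mu₂ - mu₁| / |mu₁|) := by
  have h1 : mu₁ < 0 := h12.trans h2
  have hanti := steklovMuEig_antitone γ₀ γ₁ j h12.le
  have hsub : steklovMuEig γ₀ γ₁ j mu₁ ≠ ⊤ →
      (steklovMuEig γ₀ γ₁ j mu₁).toReal - (steklovMuEig γ₀ γ₁ j mu₂).toReal ≤
        (steklovMuEig γ₀ γ₁ j mu₁).toReal * (mu₂ - mu₁) / (-mu₁) := by
    intro hfin
    have h := ENNReal.toReal_mono (ne_top_of_le_ne_top hfin hanti)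
      (ofReal_div_mul_steklovMuEig_le γ₀ γ₁ j h12.le h2)
    rw [ENNReal.toReal_mul, ENNReal.toReal_ofReal (div_nonneg_of_nonpos h2.le h1.le)] at h
    calc _ ≤ (steklovMuEig γ₀ γ₁ j mu₁).toReal -
          mu₂ / mu₁ * (steklovMuEig γ₀ γ₁ j mu₁).toReal := by gcongr
      _ = _ := by
        have := h1.ne
        field_simp
        ring
  refine ⟨hanti, hsub, fun hfin => ?_⟩
  rw [abs_of_nonneg (sub_nonneg.2 (ENNReal.toReal_mono hfin hanti)),
    abs_of_pos (sub_pos.2 h12), abs_of_neg h1]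
  exact hsub hfin
end
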